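/- Let X be a simplicial complex and M a matroid on the same finite vertex set V, with ρ the rank function of M. For each σ ∈ X, let ℓ_σ be the minimal integer k ≥ −1 such that H̃_i(lk(X,σ)) = 0 for all i ≥ k. If ρ(V \ σ) ≥ ℓ_σ + 1 for all σ ∈ X, then M is not contained in X (i.e., some independent set of M is not a face of X). -/

import Mathlib

/-- `Ind` is (the independence predicate of) a matroid. -/
structure IsMatroid {V : Type*} [DecidableEq V] (Ind : Finset V → Prop) : Prop where
  empty : Ind ∅
  subset : ∀ ⦃σ τ : Finset V⦄, Ind τ → σ ⊆ τ → Ind σ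
  exchange : ∀ ⦃A B : Finset V⦄, Ind A → Ind B → A.card < B.card →
    ∃ x ∈ B, x ∉ A ∧ Ind (insert x A)

/-- The rank of `W`: the maximal size of an independent subset of `W`. -/
def matRank {V : Type*} [DecidableEq V] (Ind : Finset V → Prop) [DecidablePred Ind]
    (W : Finset V) : ℕ :=
  (W.powerset.filter Ind).sup Finset.card

variable {V : Type*} [DecidableEq V] [LinearOrder V]

/-- Chains with `ℤ` coefficients: formal sums of faces of `K` of cardinality `n`
(so `n = 0` corresponds to the empty face, giving the *reduced* chain complex). -/
abbrev Chains (K : Finset V → Prop) (n : ℕ) : Type _ :=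
  {σ : Finset V // K σ ∧ σ.card = n} →₀ ℤ

/-- The simplicial boundary map. -/
noncomputable def bd (K : Finset V → Prop) [DecidablePred K] (n : ℕ) :
    Chains K (n + 1) →ₗ[ℤ] Chains K n :=
  Finsupp.lsum ℤ fun σ : {σ : Finset V // K σ ∧ σ.card = n + 1} =>
    LinearMap.toSpanSingleton ℤ (Chains K n)
      (∑ v ∈ σ.1.attach,
        if h : K (σ.1.erase v.1) then
          ((-1 : ℤ) ^ ((σ.1.filter (fun w => w < v.1)).card)) •
            Finsupp.single (⟨σ.1.erase v.1, h, by
              rw [Finset.card_erase_of_mem v.2, σ.2.2]; omega⟩ :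
              {τ : Finset V // K τ ∧ τ.card = n}) (1 : ℤ)
        else 0)

/-- Cycles: kernel of the boundary map (everything in the bottom degree). -/
noncomputable def cycles (K : Finset V → Prop) [DecidablePred K] :
    (n : ℕ) → Submodule ℤ (Chains K n)
  | 0 => ⊤
  | (m + 1) => LinearMap.ker (bd K m)

/-- Reduced homology: `RHom K n` is the reduced simplicial homology of `K`
in dimension `n - 1` (so `RHom K (i+1)` is `H̃ᵢ(K)`). -/
noncomputable abbrev RHom (K : Finset V → Prop) [DecidablePred K] (n : ℕ) : Type _ :=
  (cycles K n) ⧸ (Submodule.comap (cycles K n).subtype (LinearMap.range (bd K n)))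

/-- A complex is `d`-Leray if every induced subcomplex has trivial reduced homology
in dimensions `d` and higher. -/
def IsDLeray (d : ℕ) (K : Finset V → Prop) [DecidablePred K] : Prop :=
  ∀ (W : Finset V) (i : ℕ), d ≤ i →
    Subsingleton (RHom (fun σ => K σ ∧ σ ⊆ W) (i + 1))


section Generic
set_option linter.unusedSectionVars false
open Finset

/-- Rational chains on all finite subsets. -/
abbrev EE (A : Type*) := Finset A → ℚ

/-- sign -/
def sg {A : Type*} [LinearOrder A] (v : A) (σ : Finset A) : ℚ :=
  (-1 : ℚ) ^ ((σ.filter (fun w => w < v)).card)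

theorem sg_sq {A : Type*} [LinearOrder A] (v : A) (σ : Finset A) : sg v σ * sg v σ = 1 := by
  unfold sg
  rw [← pow_add, ← two_mul, pow_mul]; simp

theorem sg_insert {A : Type*} [DecidableEq A] [LinearOrder A] (w v : A) (σ : Finset A)
    (h : v ∉ σ) : sg w (insert v σ) = if v < w then - sg w σ else sg w σ := by
  unfold sg
  rw [Finset.filter_insert]
  split_ifs with hv
  · rw [Finset.card_insert_of_notMem (by simp [h])]; ring
  · rfl

theorem sg_erase {A : Type*} [DecidableEq A] [LinearOrder A] (w v : A) (σ : Finset A)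
    (h : v ∈ σ) : sg w (σ.erase v) = if v < w then - sg w σ else sg w σ := by
  have := sg_insert w v (σ.erase v) (by simp)
  rw [Finset.insert_erase h] at this
  rw [this]
  split_ifs <;> simp

theorem sg_union {A : Type*} [DecidableEq A] [LinearOrder A] (v : A) (σ τ : Finset A)
    (h : Disjoint σ τ) : sg v (σ ∪ τ) = sg v σ * sg v τ := by
  unfold sg
  rw [← pow_add, Finset.filter_union, Finset.card_union_of_disjoint]
  exact Finset.disjoint_filter_filter h

variable {A : Type*} [DecidableEq A] [LinearOrder A]

/-- contraction -/
def iop (v : A) : EE A →ₗ[ℚ] EE A where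
  toFun c := fun τ => if v ∈ τ then 0 else sg v τ * c (insert v τ)
  map_add' a b := by ext τ; simp only [Pi.add_apply]; split_ifs <;> ring
  map_smul' a b := by ext τ; simp only [Pi.smul_apply, smul_eq_mul, RingHom.id_apply]; split_ifs <;> ring

/-- wedge -/
def eop (v : A) : EE A →ₗ[ℚ] EE A where
  toFun c := fun τ => if v ∈ τ then sg v τ * c (τ.erase v) else 0
  map_add' a b := by ext τ; simp only [Pi.add_apply]; split_ifs <;> ring
  map_smul' a b := by ext τ; simp only [Pi.smul_apply, smul_eq_mul, RingHom.id_apply]; split_ifs <;> ring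

theorem iop_apply (v : A) (c : EE A) (τ : Finset A) :
    iop v c τ = if v ∈ τ then 0 else sg v τ * c (insert v τ) := rfl

theorem eop_apply (v : A) (c : EE A) (τ : Finset A) :
    eop v c τ = if v ∈ τ then sg v τ * c (τ.erase v) else 0 := rfl

theorem iop_anti (v w : A) (c : EE A) : iop v (iop w c) = - iop w (iop v c) := by
  ext τ
  simp only [iop_apply, Pi.neg_apply, Finset.mem_insert]
  by_cases hvw : v = w
  · subst hvw; simp
  by_cases hv : v ∈ τ
  · simp [hv]
  by_cases hw : w ∈ τ
  · simp [hw]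
  simp only [hv, hw, hvw, Ne.symm hvw, if_false, or_false]
  rw [sg_insert w v τ hv, sg_insert v w τ hw, Finset.insert_comm]
  rcases lt_or_gt_of_ne hvw with h | h
  · simp [h, h.not_gt]; ring
  · simp [h, h.not_gt]; ring

theorem eop_iop_same (v : A) (c : EE A) : iop v (eop v c) + eop v (iop v c) = c := by
  ext τ
  simp only [iop_apply, eop_apply, Pi.add_apply]
  by_cases hv : v ∈ τ
  · simp only [hv, if_true, Finset.notMem_erase, if_false, Finset.insert_erase hv]
    rw [sg_erase v v τ hv, if_neg (lt_irrefl v), ← mul_assoc, sg_sq]; ring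
  · simp only [hv, if_false, Finset.mem_insert_self, if_true, Finset.erase_insert hv]
    rw [sg_insert v v τ hv, if_neg (lt_irrefl v), ← mul_assoc, sg_sq]; ring

theorem eop_iop_ne (v a : A) (h : v ≠ a) (c : EE A) : iop v (eop a c) + eop a (iop v c) = 0 := by
  ext τ
  simp only [iop_apply, eop_apply, Pi.add_apply, Finset.mem_insert, Finset.mem_erase, Pi.zero_apply]
  by_cases hv : v ∈ τ
  · simp [hv, h]
  by_cases ha : a ∈ τ
  · simp only [hv, ha, if_true, if_false, or_true, and_false]
    rw [sg_insert a v τ hv, sg_erase v a τ ha, Finset.erase_insert_of_ne h]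
    rcases lt_or_gt_of_ne h with h | h
    · simp [h, h.not_gt]; ring
    · simp [h, h.not_gt]; ring
  · simp [hv, ha, Ne.symm h]

/-- the boundary operator -/
def del [Fintype A] : EE A →ₗ[ℚ] EE A := ∑ v : A, iop v

theorem del_eq [Fintype A] (c : EE A) : del c = ∑ v : A, iop v c := by
  simp [del]

theorem del_apply [Fintype A] (c : EE A) (τ : Finset A) :
    del c τ = ∑ v : A, if v ∈ τ then 0 else sg v τ * c (insert v τ) := by
  simp [del, iop_apply]

theorem del_del [Fintype A] (c : EE A) : del (del c) = 0 := by
  have h : del (del c) = - del (del c) := by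
    conv_lhs => rw [del_eq, del_eq]
    conv_rhs => rw [del_eq, del_eq]
    simp only [map_sum]
    refine Finset.sum_comm.trans ?_
    rw [← Finset.sum_neg_distrib]
    refine Finset.sum_congr rfl fun v _ => ?_
    rw [← Finset.sum_neg_distrib]
    exact Finset.sum_congr rfl fun w _ => iop_anti _ _ _
  exact self_eq_neg.mp h

theorem del_eop [Fintype A] (a : A) (c : EE A) : del (eop a c) + eop a (del c) = c := by
  rw [del_eq, del_eq, map_sum, ← Finset.sum_add_distrib, Finset.sum_eq_single a]
  · exact eop_iop_same a c
  · intro v _ hv; exact eop_iop_ne v a hv c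
  · simp

/-- basis element -/
def bs (σ : Finset A) : EE A := Pi.single σ 1

theorem bs_apply (σ τ : Finset A) : bs σ τ = if τ = σ then 1 else 0 := by
  simp [bs, Pi.single_apply]

theorem del_bs [Fintype A] (σ : Finset A) :
    del (bs σ) = ∑ v ∈ σ, sg v σ • bs (σ.erase v) := by
  ext τ
  rw [del_apply, Finset.sum_apply, ← Finset.sum_filter_add_sum_filter_not univ (fun v => v ∈ σ)]
  rw [Finset.sum_eq_zero (s := univ.filter (fun v => ¬ v ∈ σ)), add_zero]
  · rw [Finset.filter_mem_eq_inter, Finset.univ_inter]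
    refine Finset.sum_congr rfl fun v hv => ?_
    simp only [bs_apply, Pi.smul_apply, smul_eq_mul]
    by_cases h : τ = σ.erase v
    · subst h; simp [Finset.insert_erase hv, sg_erase v v σ hv]
    · by_cases h2 : v ∈ τ
      · simp [h, h2]
      · have : insert v τ ≠ σ := by rintro rfl; exact h (by simp [h2])
        simp [h, this]
  · intro v hv
    have hv : v ∉ σ := by simpa using hv
    have : insert v τ ≠ σ := by rintro rfl; exact hv (by simp)
    simp [bs_apply, this]

/-- linear extension of a family -/
def lext [Fintype A] {M : Type*} [AddCommGroup M] [Module ℚ M] (F : Finset A → M) : EE A →ₗ[ℚ] M :=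
  Fintype.linearCombination ℚ F

theorem lext_apply [Fintype A] {M : Type*} [AddCommGroup M] [Module ℚ M] (F : Finset A → M) (c : EE A) :
    lext F c = ∑ σ, c σ • F σ := by
  simp [lext, Fintype.linearCombination_apply]

theorem lext_bs [Fintype A] {M : Type*} [AddCommGroup M] [Module ℚ M] (F : Finset A → M) (σ : Finset A) :
    lext F (bs σ) = F σ := by
  simp [lext_apply, bs_apply]

theorem lext_del_bs [Fintype A] {M : Type*} [AddCommGroup M] [Module ℚ M] (F : Finset A → M) (σ : Finset A) :
    lext F (del (bs σ)) = ∑ v ∈ σ, sg v σ • F (σ.erase v) := by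
  simp [del_bs, lext_bs]

theorem lin_ext [Fintype A] {M : Type*} [AddCommGroup M] [Module ℚ M] {f g : EE A →ₗ[ℚ] M}
    (h : ∀ σ, f (bs σ) = g (bs σ)) : f = g := by
  apply LinearMap.pi_ext'
  intro σ
  ext
  simpa [bs] using h σ

/-- supported in S -/
def SuppIn (S : Finset A → Prop) (c : EE A) : Prop := ∀ σ, c σ ≠ 0 → S σ

theorem SuppIn.mono {S T : Finset A → Prop} {c : EE A} (h : SuppIn S c) (hST : ∀ σ, S σ → T σ) : SuppIn T c :=
  fun σ hσ => hST σ (h σ hσ)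

theorem SuppIn.sum {S : Finset A → Prop} {ι : Type*} (s : Finset ι) (a : ι → ℚ) (c : ι → EE A)
    (h : ∀ i ∈ s, a i ≠ 0 → SuppIn S (c i)) : SuppIn S (∑ i ∈ s, a i • c i) := by
  intro σ hσ
  rw [Finset.sum_apply] at hσ
  obtain ⟨i, hi, hne⟩ := Finset.exists_ne_zero_of_sum_ne_zero hσ
  simp only [Pi.smul_apply, smul_eq_mul] at hne
  exact h i hi (left_ne_zero_of_mul hne) σ (right_ne_zero_of_mul hne)

/-- Acyclic carrier lemma. -/
theorem acyclic_carrier {B : Type*} [DecidableEq B] [LinearOrder B] [Fintype B] [Fintype A]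
    (P : Finset A → Prop) (hP : ∀ ⦃σ τ : Finset A⦄, P τ → σ ⊆ τ → P σ)
    (Car : Finset A → Finset B → Prop)
    (hmono : ∀ ⦃σ τ : Finset A⦄, σ ⊆ τ → P τ → ∀ ω, Car σ ω → Car τ ω)
    (h0 : Car ∅ ∅)
    (hac : ∀ (T : Finset A) (n : ℕ), P T → T.card = n + 1 → ∀ z : EE B,
      SuppIn (fun ω => Car T ω ∧ ω.card = n) z → del z = 0 →
      ∃ y : EE B, SuppIn (fun ω => Car T ω ∧ ω.card = n + 1) y ∧ del y = z) :
    ∃ F : Finset A → EE B, F ∅ = bs ∅ ∧ (∀ T, ¬ P T → T ≠ ∅ → F T = 0) ∧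
      ∀ T, P T → SuppIn (fun ω => Car T ω ∧ ω.card = T.card) (F T) ∧
        del (F T) = ∑ v ∈ T, sg v T • F (T.erase v) := by
  classical
  have key : ∀ n : ℕ, ∃ F : Finset A → EE B, F ∅ = bs ∅ ∧ (∀ T, ¬ P T → T ≠ ∅ → F T = 0) ∧
      ∀ T, P T → T.card ≤ n → SuppIn (fun ω => Car T ω ∧ ω.card = T.card) (F T) ∧
        del (F T) = ∑ v ∈ T, sg v T • F (T.erase v) := by
    intro n
    induction n with
    | zero =>
      refine ⟨fun T => if T = ∅ then bs ∅ else 0, by simp, ?_, ?_⟩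
      · intro T _ h; simp [h]
      · intro T hT hc
        have : T = ∅ := by simpa using hc
        subst this
        refine ⟨?_, by simp [del_bs]⟩
        intro ω hω
        simp only [if_true, bs_apply] at hω
        have : ω = ∅ := by by_contra h; simp [h] at hω
        subst this
        exact ⟨h0, rfl⟩
    | succ n ih =>
      obtain ⟨F, hF0, hFP, hF⟩ := ih
      have hex : ∀ T, P T → T.card = n + 1 → ∃ y : EE B,
          SuppIn (fun ω => Car T ω ∧ ω.card = n + 1) y ∧
          del y = ∑ v ∈ T, sg v T • F (T.erase v) := by
        intro T hT hc
        apply hac T n hT hc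
        · apply SuppIn.sum
          intro v hv _
          have hce : (T.erase v).card = n := by rw [Finset.card_erase_of_mem hv]; omega
          have := (hF (T.erase v) (hP hT (Finset.erase_subset _ _)) (by omega)).1
          rw [hce] at this
          exact this.mono fun ω h => ⟨hmono (Finset.erase_subset _ _) hT ω h.1, h.2⟩
        · have h1 : ∀ v ∈ T, del (F (T.erase v)) = lext F (del (bs (T.erase v))) := by
            intro v hv
            rw [lext_del_bs]
            have hce : (T.erase v).card = n := by rw [Finset.card_erase_of_mem hv]; omega
            exact (hF (T.erase v) (hP hT (Finset.erase_subset _ _)) (by omega)).2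
          calc del (∑ v ∈ T, sg v T • F (T.erase v))
              = ∑ v ∈ T, sg v T • lext F (del (bs (T.erase v))) := by
                rw [map_sum]
                refine Finset.sum_congr rfl fun v hv => ?_
                rw [map_smul, h1 v hv]
            _ = lext F (del (del (bs T))) := by
                conv_rhs => rw [del_bs]
                simp only [map_sum, map_smul]
            _ = 0 := by rw [del_del, map_zero]
      choose! Y hY using hex
      refine ⟨fun T => if P T ∧ T.card = n + 1 then Y T else F T, ?_, ?_, ?_⟩
      · simp [hF0]
      · intro T h1 h2
        simp [h1, hFP T h1 h2]
      · intro T hT hc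
        have hsum : ∑ v ∈ T, sg v T •
            (fun T => if P T ∧ T.card = n + 1 then Y T else F T) (T.erase v)
            = ∑ v ∈ T, sg v T • F (T.erase v) := by
          refine Finset.sum_congr rfl fun v hv => ?_
          have hce : (T.erase v).card ≠ n + 1 := by
            have := Finset.card_pos.mpr ⟨v, hv⟩
            rw [Finset.card_erase_of_mem hv]; omega
          simp [hce]
        rw [hsum]
        by_cases h : T.card = n + 1
        · simp only [hT, h, and_self, if_true]
          exact hY T hT h
        · simp only [h, and_false, if_false]
          exact hF T hT (by omega)
  obtain ⟨F, h1, h2, h3⟩ := key (Fintype.card A)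
  exact ⟨F, h1, h2, fun T hT => h3 T hT (Finset.card_le_univ T)⟩

/-- Lefschetz / Hopf trace contradiction on a cone. -/
theorem cone_trace [Fintype A] (P : Finset A → Prop) (hP : ∀ ⦃σ τ : Finset A⦄, P τ → σ ⊆ τ → P σ)
    (m : A) (hm : ∀ T, P T → P (insert m T))
    (H : Finset A → EE A) (H0 : H ∅ = bs ∅) (HP : ∀ T, ¬ P T → H T = 0)
    (HS : ∀ T, P T → SuppIn P (H T))
    (Hd : ∀ T, P T → del (H T) = ∑ v ∈ T, sg v T • H (T.erase v))
    (Hfix : ∀ T, T ≠ ∅ → H T T = 0) : False := by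
  classical
  let h : EE A →ₗ[ℚ] EE A := lext H
  let p : EE A →ₗ[ℚ] EE A := lext (fun T => if P T then bs T else 0)
  let D : EE A →ₗ[ℚ] EE A := lext (fun T => (-1 : ℚ) ^ T.card • bs T)
  have hpap : ∀ c T, p c T = if P T then c T else 0 := by
    intro c T
    simp only [p, lext_apply, Finset.sum_apply, Pi.smul_apply, smul_eq_mul]
    rw [Finset.sum_eq_single T]
    · split_ifs <;> simp [bs_apply]
    · intro S _ hS
      split_ifs <;> simp [bs_apply, hS.symm]
    · simp
  have hDap : ∀ c T, D c T = (-1 : ℚ) ^ T.card * c T := by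
    intro c T
    simp only [D, lext_apply, Finset.sum_apply, Pi.smul_apply, smul_eq_mul]
    rw [Finset.sum_eq_single T]
    · simp [bs_apply]; ring
    · intro S _ hS
      simp [bs_apply, hS.symm]
    · simp
  have hpbs : ∀ T, p (bs T) = if P T then bs T else 0 := fun T => lext_bs _ _
  have hpfix : ∀ c, SuppIn P c → p c = c := by
    intro c hc; ext T; rw [hpap]
    split_ifs with hT
    · rfl
    · by_contra h; exact hT (hc T (Ne.symm h))
  have hpS : ∀ c, SuppIn P (p c) := by
    intro c T hT; rw [hpap] at hT; by_contra h; simp [h] at hT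
  have delS : ∀ c, SuppIn P c → SuppIn P (del c) := by
    intro c hc T hT
    rw [del_apply] at hT
    obtain ⟨v, _, hv⟩ := Finset.exists_ne_zero_of_sum_ne_zero hT
    split_ifs at hv with h1
    · exact absurd rfl hv
    · exact hP (hc _ (right_ne_zero_of_mul hv)) (Finset.subset_insert _ _)
  have eS : ∀ c, SuppIn P c → SuppIn P (eop m c) := by
    intro c hc T hT
    rw [eop_apply] at hT
    split_ifs at hT with h1
    · have := hm _ (hc _ (right_ne_zero_of_mul hT))
      rwa [Finset.insert_erase h1] at this
    · exact absurd rfl hT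
  let d' := del ∘ₗ p
  let e' := eop m ∘ₗ p
  have hhd : h ∘ₗ d' = d' ∘ₗ h := by
    apply lin_ext
    intro T
    simp only [LinearMap.comp_apply, d', h, lext_bs, hpbs]
    by_cases hT : P T
    · rw [if_pos hT, lext_del_bs, hpfix _ (HS T hT), Hd T hT]
    · rw [if_neg hT, HP T hT]; simp
  have hDd : D * d' + d' * D = 0 := by
    apply LinearMap.ext
    intro c
    ext T
    simp only [LinearMap.add_apply, Module.End.mul_apply, Pi.add_apply, hDap, d',
      LinearMap.comp_apply, del_apply, LinearMap.zero_apply, Pi.zero_apply]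
    rw [Finset.mul_sum, ← Finset.sum_add_distrib]
    refine Finset.sum_eq_zero fun v _ => ?_
    by_cases hv : v ∈ T
    · simp [hv]
    · simp only [hv, if_false, hpap, hDap, Finset.card_insert_of_notMem hv]
      split_ifs <;> ring
  have hhom : d' * e' + e' * d' = p := by
    apply LinearMap.ext
    intro c
    simp only [LinearMap.add_apply, Module.End.mul_apply, d', e', LinearMap.comp_apply]
    rw [hpfix _ (eS _ (hpS c)), hpfix _ (delS _ (hpS c))]
    exact del_eop m (p c)
  have hhp : h ∘ₗ p = h := by
    apply lin_ext
    intro T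
    simp only [LinearMap.comp_apply, hpbs]
    by_cases hT : P T
    · rw [if_pos hT]
    · rw [if_neg hT]; simp [h, lext_bs, HP T hT]
  have htr0 : LinearMap.trace ℚ (EE A) (D * h) = 0 := by
    have e1 : D * h = D * d' * h * e' + D * h * e' * d' := by
      calc D * h = D * (h * (d' * e' + e' * d')) := by
            rw [hhom]; exact congrArg (D * ·) hhp.symm
        _ = D * (h * d') * e' + D * h * e' * d' := by
            simp only [mul_add, mul_assoc]
        _ = D * (d' * h) * e' + D * h * e' * d' := by
            rw [show h * d' = d' * h from hhd]
        _ = _ := by simp only [mul_assoc]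
    have e3 : D * d' * h * e' + d' * (D * h * e') = 0 := by
      calc _ = (D * d' + d' * D) * (h * e') := by simp only [add_mul, mul_assoc]
        _ = 0 := by rw [hDd, zero_mul]
    rw [e1, map_add, LinearMap.trace_mul_comm ℚ (D * h * e') d', ← map_add, e3, map_zero]
  have htr1 : LinearMap.trace ℚ (EE A) (D * h) = 1 := by
    rw [LinearMap.trace_eq_matrix_trace ℚ (Pi.basisFun ℚ (Finset A)), Matrix.trace]
    rw [Finset.sum_eq_single ∅]
    · simp only [Matrix.diag_apply, LinearMap.toMatrix_apply, Pi.basisFun_apply, Pi.basisFun_repr, Module.End.mul_apply]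
      change D (h (bs ∅)) ∅ = 1
      rw [hDap]; simp [h, lext_bs, H0, bs_apply]
    · intro T _ hT
      simp only [Matrix.diag_apply, LinearMap.toMatrix_apply, Pi.basisFun_apply, Pi.basisFun_repr, Module.End.mul_apply]
      change D (h (bs T)) T = 0
      rw [hDap]; simp [h, lext_bs, Hfix T hT]
    · simp
  rw [htr0] at htr1
  exact zero_ne_one htr1


theorem extend_to_rat {M N : Type*} [AddCommGroup M] [AddCommGroup N] (f : M →ₗ[ℤ] N)
    (Ψ : M →ₗ[ℤ] ℚ) (h : ∀ x, f x = 0 → Ψ x = 0) : ∃ X : N →ₗ[ℤ] ℚ, ∀ x, X (f x) = Ψ x := by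
  have hb : Module.Baer ℤ ℚ := Module.Baer.of_divisible ℚ
  let Q := LinearMap.ker f
  let q : (M ⧸ Q) →ₗ[ℤ] ℚ := Q.liftQ Ψ (fun x hx => h x hx)
  let i : (M ⧸ Q) →ₗ[ℤ] N := Q.liftQ f le_rfl
  have hi : Function.Injective i := by
    rw [← LinearMap.ker_eq_bot]
    exact Submodule.ker_liftQ_eq_bot _ _ _ le_rfl
  obtain ⟨X, hX⟩ := hb.extension_property i hi q
  refine ⟨X, fun x => ?_⟩
  have := congrArg (fun g => g (Q.mkQ x)) hX
  simp only [LinearMap.comp_apply, i, q, Submodule.mkQ_apply] at this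
  exact this

theorem bd_pair (L : Finset A → Prop) [DecidablePred L]
    (hL : ∀ ⦃σ τ : Finset A⦄, L τ → σ ⊆ τ → L σ) (n : ℕ) (X : Chains L n →ₗ[ℤ] ℚ)
    (χ : Finset A → ℚ) (hχ : ∀ σ : {σ : Finset A // L σ ∧ σ.card = n}, X (Finsupp.single σ 1) = χ σ.1)
    (σ : {σ : Finset A // L σ ∧ σ.card = n + 1}) :
    X (bd L n (Finsupp.single σ 1)) = ∑ v ∈ σ.1, sg v σ.1 * χ (σ.1.erase v) := by
  unfold bd
  rw [Finsupp.lsum_single, LinearMap.toSpanSingleton_apply, one_smul, map_sum]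
  rw [← Finset.sum_attach σ.1]
  refine Finset.sum_congr rfl fun v _ => ?_
  have h : L (σ.1.erase v.1) := hL σ.2.1 (Finset.erase_subset _ _)
  rw [dif_pos h, map_smul, hχ]
  simp [sg]

theorem cohom (L : Finset A → Prop) [DecidablePred L]
    (hL : ∀ ⦃σ τ : Finset A⦄, L τ → σ ⊆ τ → L σ) (i : ℕ) (hs : Subsingleton (RHom L i))
    (ψ : Finset A → ℚ)
    (hψ : ∀ σ, L σ → σ.card = i + 1 → ∑ v ∈ σ, sg v σ * ψ (σ.erase v) = 0) :
    ∃ χ : Finset A → ℚ, (∀ σ, χ σ ≠ 0 → L σ ∧ σ.card + 1 = i) ∧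
      ∀ σ, L σ → σ.card = i → ∑ v ∈ σ, sg v σ * χ (σ.erase v) = ψ σ := by
  have hcyc : ∀ c ∈ cycles L i, ∃ b, bd L i b = c := by
    rw [Submodule.Quotient.subsingleton_iff] at hs
    intro c hc
    have : (⟨c, hc⟩ : cycles L i) ∈ Submodule.comap (cycles L i).subtype (LinearMap.range (bd L i)) := by
      rw [hs]; trivial
    simpa using this
  let Ψ : Chains L i →ₗ[ℤ] ℚ := Finsupp.linearCombination ℤ (fun σ => ψ σ.1)
  have hΨ : ∀ σ : {σ : Finset A // L σ ∧ σ.card = i}, Ψ (Finsupp.single σ 1) = ψ σ.1 := by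
    intro σ; simp [Ψ]
  have hΨbd : ∀ b, Ψ (bd L i b) = 0 := by
    intro b
    have : Ψ ∘ₗ bd L i = 0 := by
      apply Finsupp.lhom_ext'
      intro σ
      ext
      simp only [LinearMap.comp_apply, Finsupp.lsingle_apply, LinearMap.zero_apply]
      rw [bd_pair L hL i Ψ ψ hΨ σ]
      exact hψ σ.1 σ.2.1 σ.2.2
    exact congrArg (fun g => g b) this
  have hΨc : ∀ c ∈ cycles L i, Ψ c = 0 := by
    intro c hc
    obtain ⟨b, rfl⟩ := hcyc c hc
    exact hΨbd b
  cases i with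
  | zero =>
    refine ⟨0, by simp, ?_⟩
    intro σ hσ hc
    have h1 := hΨc (Finsupp.single ⟨σ, hσ, hc⟩ 1) (by simp [cycles])
    rw [hΨ] at h1
    simp [h1]
  | succ j =>
    obtain ⟨X, hX⟩ := extend_to_rat (bd L j) Ψ (fun x hx => hΨc x (by simpa [cycles] using hx))
    let χ : Finset A → ℚ := fun τ => if h : L τ ∧ τ.card = j then X (Finsupp.single ⟨τ, h⟩ 1) else 0
    refine ⟨χ, ?_, ?_⟩
    · intro σ hσ
      by_cases h : L σ ∧ σ.card = j
      · exact ⟨h.1, by omega⟩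
      · simp [χ, h] at hσ
    · intro σ hσ hc
      rw [← hΨ ⟨σ, hσ, hc⟩, ← hX]
      symm
      refine bd_pair L hL j X χ (fun τ => ?_) ⟨σ, hσ, hc⟩
      simp only [χ]
      rw [dif_pos τ.2]

/-- Hodge star type sign -/
def eps (W σ : Finset A) : ℚ := ∏ u ∈ σ, sg u W

theorem eps_sq (W σ : Finset A) : eps W σ * eps W σ = 1 := by
  unfold eps
  rw [← Finset.prod_mul_distrib]
  exact Finset.prod_eq_one fun u _ => sg_sq _ _

/-- star operator -/
def star' (W : Finset A) (c : EE A) : EE A := fun τ => if τ ⊆ W then eps W (W \ τ) * c (W \ τ) else 0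

theorem del_star' [Fintype A] (W : Finset A) (c : EE A) (τ : Finset A) (hτ : τ ⊆ W) :
    del (star' W c) τ = eps W (W \ τ) * ∑ v ∈ W \ τ, sg v (W \ τ) * c ((W \ τ).erase v) := by
  rw [del_apply, Finset.mul_sum, ← Finset.sum_subset (Finset.subset_univ (W \ τ))]
  · refine Finset.sum_congr rfl fun v hv => ?_
    have hv' := Finset.mem_sdiff.mp hv
    have hsub : insert v τ ⊆ W := Finset.insert_subset hv'.1 hτ
    have he : W \ insert v τ = (W \ τ).erase v := by
      ext u; simp only [Finset.mem_sdiff, Finset.mem_insert, Finset.mem_erase]; tauto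
    rw [if_neg hv'.2]
    simp only [star', hsub, if_true, he]
    have h1 : eps W (W \ τ) = sg v W * eps W ((W \ τ).erase v) := by
      unfold eps; exact (Finset.mul_prod_erase _ (fun u => sg u W) hv).symm
    have h2 : sg v W = sg v τ * sg v (W \ τ) := by
      rw [← sg_union _ _ _ Finset.disjoint_sdiff, Finset.union_sdiff_of_subset hτ]
    rw [h1, h2]
    have h3 := sg_sq v (W \ τ)
    linear_combination (- sg v τ * eps W ((W \ τ).erase v) * c ((W \ τ).erase v)) * h3
  · intro v _ hv
    by_cases h : v ∈ τ
    · simp [h]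
    · have hw : v ∉ W := fun h' => hv (Finset.mem_sdiff.mpr ⟨h', h⟩)
      have : ¬ insert v τ ⊆ W := fun h' => hw (h' (Finset.mem_insert_self _ _))
      simp [star', this]

theorem fill [Fintype A] (K : Finset A → Prop) [DecidablePred K]
    (hcomplex : ∀ ⦃σ τ : Finset A⦄, K τ → σ ⊆ τ → K σ) (W : Finset A) (hW : W.Nonempty) (r : ℕ)
    (hex : ∀ i, r ≤ i → Subsingleton (RHom (fun τ : Finset A =>
      τ ∩ (Finset.univ \ W) = ∅ ∧ K ((Finset.univ \ W) ∪ τ)) i))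
    (a : ℕ) (ha : a + 1 + r ≤ W.card) (z : EE A)
    (hz : SuppIn (fun ω => (¬ K (Finset.univ \ ω) ∧ ω ⊆ W) ∧ ω.card = a) z) (hdz : del z = 0) :
    ∃ y : EE A, SuppIn (fun ω => (¬ K (Finset.univ \ ω) ∧ ω ⊆ W) ∧ ω.card = a + 1) y ∧ del y = z := by
  obtain ⟨w, hw⟩ := hW
  set y0 := eop w z with hy0
  have hdy0 : del y0 = z := by
    have := del_eop w z
    rwa [hdz, map_zero, add_zero] at this
  have hy0s : ∀ τ, y0 τ ≠ 0 → τ ⊆ W ∧ τ.card = a + 1 := by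
    intro τ hτ
    rw [hy0, eop_apply] at hτ
    split_ifs at hτ with h
    · have := hz _ (right_ne_zero_of_mul hτ)
      have h1 := Finset.insert_erase h
      refine ⟨?_, ?_⟩
      · rw [← h1]; exact Finset.insert_subset hw this.1.2
      · rw [← Finset.card_erase_add_one h, this.2]
    · exact absurd rfl hτ
  set L : Finset A → Prop := fun τ : Finset A =>
      τ ∩ (Finset.univ \ W) = ∅ ∧ K ((Finset.univ \ W) ∪ τ) with hLdef
  have hLW : ∀ τ, L τ ↔ (τ ⊆ W ∧ K (Finset.univ \ (W \ τ))) := by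
    intro τ
    have e1 : τ ∩ (Finset.univ \ W) = ∅ ↔ τ ⊆ W := by
      rw [← Finset.disjoint_iff_inter_eq_empty, Finset.disjoint_left]
      simp [Finset.subset_iff]
    have e2 : τ ⊆ W → (Finset.univ \ W) ∪ τ = Finset.univ \ (W \ τ) := by
      intro h; ext u; simp only [Finset.mem_union, Finset.mem_sdiff, Finset.mem_univ, true_and]; tauto
    rw [hLdef]
    simp only [e1]
    constructor
    · rintro ⟨h1, h2⟩; rw [e2 h1] at h2; exact ⟨h1, h2⟩
    · rintro ⟨h1, h2⟩; rw [← e2 h1] at h2; exact ⟨h1, h2⟩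
  have hL : ∀ ⦃σ τ : Finset A⦄, L τ → σ ⊆ τ → L σ := by
    intro σ τ h hs
    rw [hLW] at h ⊢
    refine ⟨hs.trans h.1, hcomplex h.2 ?_⟩
    intro u
    simp only [Finset.mem_sdiff, Finset.mem_univ, true_and]
    intro h1 h2; exact h1 ⟨h2.1, fun h3 => h2.2 (hs h3)⟩
  obtain ⟨i, hi⟩ : ∃ i, W.card = a + 1 + i := ⟨W.card - (a + 1), by omega⟩
  let ψ : EE A := fun σ => if σ ⊆ W then eps W σ * y0 (W \ σ) else 0
  have hstar : star' W ψ = y0 := by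
    ext τ
    by_cases h : τ ⊆ W
    · simp only [star', ψ, h, if_true, Finset.sdiff_subset, Finset.sdiff_sdiff_eq_self]
      rw [← mul_assoc, eps_sq, one_mul]
    · simp only [star', h, if_false]
      by_contra h'
      exact h (hy0s τ (Ne.symm h')).1
  obtain ⟨χ, hχs, hχ⟩ := cohom L hL i (hex i (by omega)) ψ (by
    intro σ hσ hc
    have hσ' := (hLW σ).mp hσ
    have h1 := del_star' W ψ (W \ σ) Finset.sdiff_subset
    rw [hstar, hdy0, Finset.sdiff_sdiff_eq_self hσ'.1] at h1
    have h2 : z (W \ σ) = 0 := by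
      by_contra h
      exact (hz _ h).1.1 hσ'.2
    rw [h2] at h1
    rcases mul_eq_zero.mp h1.symm with h | h
    · have := eps_sq W σ
      rw [h] at this; norm_num at this
    · exact h)
  refine ⟨y0 - del (star' W χ), ?_, by rw [map_sub, del_del, sub_zero, hdy0]⟩
  intro τ hτ
  have hds : del (star' W χ) τ ≠ 0 → τ ⊆ W ∧ τ.card = a + 1 := by
    intro h
    rw [del_apply] at h
    obtain ⟨v, _, hv⟩ := Finset.exists_ne_zero_of_sum_ne_zero h
    split_ifs at hv with h1
    · exact absurd rfl hv
    have h2 := right_ne_zero_of_mul hv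
    unfold star' at h2
    split_ifs at h2 with h3
    · have h4 := (hχs _ (right_ne_zero_of_mul h2)).2
      have h5 := Finset.card_sdiff_add_card_eq_card h3
      rw [Finset.card_insert_of_notMem h1] at h5
      exact ⟨(Finset.subset_insert _ _).trans h3, by omega⟩
    · exact absurd rfl h2
  have hmain : τ ⊆ W ∧ τ.card = a + 1 := by
    by_cases h : y0 τ = 0
    · apply hds
      intro h'
      apply hτ
      simp [h, h']
    · exact hy0s τ h
  refine ⟨⟨?_, hmain.1⟩, hmain.2⟩
  intro hK
  apply hτ
  have hc : (W \ τ).card = i := by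
    have := Finset.card_sdiff_add_card_eq_card hmain.1
    omega
  have h1 := hχ (W \ τ) ((hLW _).mpr ⟨Finset.sdiff_subset, by
    rwa [Finset.sdiff_sdiff_eq_self hmain.1]⟩) hc
  rw [Pi.sub_apply, del_star' W χ τ hmain.1, h1]
  simp only [ψ, Finset.sdiff_subset, if_true, Finset.sdiff_sdiff_eq_self hmain.1]
  rw [← mul_assoc, eps_sq, one_mul, sub_self]

end Generic

section MatroidPart
variable {A : Type*} [DecidableEq A]

/-- circuits -/
def IsCirc (Ind : Finset A → Prop) (C : Finset A) : Prop := ¬ Ind C ∧ ∀ u ∈ C, Ind (C.erase u)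

/-- unions of circuits -/
def IsCyc (Ind : Finset A → Prop) (W : Finset A) : Prop :=
  ∀ v ∈ W, ∃ C, IsCirc Ind C ∧ v ∈ C ∧ C ⊆ W

open Classical in
/-- largest cyclic subset -/
noncomputable def core (Ind : Finset A → Prop) (W : Finset A) : Finset A :=
  W.filter (fun v => ∃ C, IsCirc Ind C ∧ v ∈ C ∧ C ⊆ W)

theorem mem_core {Ind : Finset A → Prop} {W : Finset A} {v : A} :
    v ∈ core Ind W ↔ ∃ C, IsCirc Ind C ∧ v ∈ C ∧ C ⊆ W := by
  classical
  unfold core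
  rw [Finset.mem_filter]
  constructor
  · exact fun h => h.2
  · rintro ⟨C, h1, h2, h3⟩; exact ⟨h3 h2, C, h1, h2, h3⟩

theorem core_subset (Ind : Finset A → Prop) (W : Finset A) : core Ind W ⊆ W := by
  intro v hv
  obtain ⟨C, _, h2, h3⟩ := mem_core.mp hv
  exact h3 h2

theorem core_mono (Ind : Finset A → Prop) {W W' : Finset A} (h : W ⊆ W') : core Ind W ⊆ core Ind W' := by
  intro v hv
  obtain ⟨C, h1, h2, h3⟩ := mem_core.mp hv
  exact mem_core.mpr ⟨C, h1, h2, h3.trans h⟩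

theorem core_cyc (Ind : Finset A → Prop) (W : Finset A) : IsCyc Ind (core Ind W) := by
  intro v hv
  obtain ⟨C, h1, h2, h3⟩ := mem_core.mp hv
  exact ⟨C, h1, h2, fun u hu => mem_core.mpr ⟨C, h1, hu, h3⟩⟩

theorem IsCyc.subset_core {Ind : Finset A → Prop} {W W' : Finset A} (h : IsCyc Ind W) (hs : W ⊆ W') :
    W ⊆ core Ind W' := by
  intro v hv
  obtain ⟨C, h1, h2, h3⟩ := h v hv
  exact mem_core.mpr ⟨C, h1, h2, h3.trans hs⟩

theorem core_nonempty {Ind : Finset A → Prop} (hM : IsMatroid Ind) {W : Finset A} (h : ¬ Ind W) :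
    (core Ind W).Nonempty := by
  classical
  obtain ⟨C, hC, hmin⟩ := Finset.exists_min_image (W.powerset.filter (fun C => ¬ Ind C)) Finset.card
    ⟨W, by simp [h]⟩
  simp only [Finset.mem_filter, Finset.mem_powerset] at hC hmin
  have hne : C.Nonempty := by
    rw [Finset.nonempty_iff_ne_empty]; rintro rfl; exact hC.2 hM.empty
  obtain ⟨v, hv⟩ := hne
  refine ⟨v, mem_core.mpr ⟨C, ⟨hC.2, fun u hu => ?_⟩, hv, hC.1⟩⟩
  by_contra hI
  have := hmin (C.erase u) ⟨(Finset.erase_subset _ _).trans hC.1, hI⟩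
  have := Finset.card_erase_lt_of_mem hu
  omega

variable {Ind : Finset A → Prop} [DecidablePred Ind]

theorem le_rank {I W : Finset A} (hI : Ind I) (hs : I ⊆ W) : I.card ≤ matRank Ind W := by
  unfold matRank
  exact Finset.le_sup (f := Finset.card) (by simp [hI, hs])

theorem exists_rank (hM : IsMatroid Ind) (W : Finset A) : ∃ J, J ⊆ W ∧ Ind J ∧ J.card = matRank Ind W := by
  unfold matRank
  obtain ⟨J, hJ, h⟩ := Finset.exists_mem_eq_sup (W.powerset.filter Ind) ⟨∅, by simp [hM.empty]⟩ Finset.card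
  simp only [Finset.mem_filter, Finset.mem_powerset] at hJ
  exact ⟨J, hJ.1, hJ.2, h.symm⟩

theorem exists_basis (hM : IsMatroid Ind) {I W : Finset A} (hI : Ind I) (hs : I ⊆ W) :
    ∃ J, I ⊆ J ∧ J ⊆ W ∧ Ind J ∧ J.card = matRank Ind W := by
  obtain ⟨J, hJ, hmax⟩ := Finset.exists_max_image
    (W.powerset.filter (fun J => Ind J ∧ I ⊆ J)) Finset.card ⟨I, by simp [hI, hs]⟩
  simp only [Finset.mem_filter, Finset.mem_powerset] at hJ hmax
  refine ⟨J, hJ.2.2, hJ.1, hJ.2.1, ?_⟩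
  obtain ⟨B, hB1, hB2, hB3⟩ := exists_rank hM W
  by_contra hne
  have h1 := le_rank hJ.2.1 hJ.1
  obtain ⟨x, hx, hxJ, hxI⟩ := hM.exchange hJ.2.1 hB2 (by omega)
  have := hmax (insert x J) ⟨Finset.insert_subset (hB1 hx) hJ.1, hxI, hJ.2.2.trans (Finset.subset_insert _ _)⟩
  rw [Finset.card_insert_of_notMem hxJ] at this
  omega

theorem rank_erase (hM : IsMatroid Ind) {C W : Finset A} {v : A} (hC : IsCirc Ind C) (hv : v ∈ C)
    (hs : C ⊆ W) : matRank Ind W ≤ matRank Ind (W.erase v) := by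
  obtain ⟨J, h1, h2, h3, h4⟩ := exists_basis hM (hC.2 v hv) (Finset.erase_subset_erase v hs)
  obtain ⟨B, hB1, hB2, hB3⟩ := exists_rank hM W
  by_contra hlt
  obtain ⟨x, hx, hxJ, hxI⟩ := hM.exchange h3 hB2 (by omega)
  by_cases hxv : x = v
  · subst hxv
    exact hC.1 (hM.subset hxI (by rw [← Finset.insert_erase hv]; exact Finset.insert_subset_insert _ h1))
  · have := le_rank (W := W.erase v) hxI (Finset.insert_subset (by simp [hxv, hB1 hx]) h2)
    rw [Finset.card_insert_of_notMem hxJ] at this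
    omega

theorem rank_diff (hM : IsMatroid Ind) {W W' : Finset A} (hs : W ⊆ W') :
    matRank Ind W' + W.card ≤ matRank Ind W + W'.card := by
  obtain ⟨J, h1, h2, h3⟩ := exists_rank hM W'
  have h4 := le_rank (W := W) (hM.subset h2 (Finset.inter_subset_left (s₂ := W))) Finset.inter_subset_right
  have h5 := Finset.card_inter_add_card_sdiff J W
  have h6 : (J \ W).card ≤ (W' \ W).card := Finset.card_le_card (Finset.sdiff_subset_sdiff h1 le_rfl)
  have h7 := Finset.card_sdiff_add_card_eq_card hs
  omega

theorem null_strict (hM : IsMatroid Ind) {W W' : Finset A} (hs : W ⊂ W') (hc : IsCyc Ind W') :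
    W.card + 1 + matRank Ind W' ≤ W'.card + matRank Ind W := by
  obtain ⟨v, hv, hvW⟩ := Finset.exists_of_ssubset hs
  obtain ⟨C, hC, hvC, hCW⟩ := hc v hv
  have h1 := rank_erase hM hC hvC hCW
  have h2 := rank_diff hM (W := W) (W' := W'.erase v) (Finset.subset_erase.mpr ⟨hs.1, hvW⟩)
  have h3 := Finset.card_erase_add_one hv
  omega

theorem rank_empty : matRank Ind ∅ = 0 := by
  unfold matRank
  rw [← Nat.le_zero]
  refine Finset.sup_le fun J hJ => ?_
  simp at hJ
  simp [hJ.1]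

theorem flag_max {ι : Type*} [DecidableEq ι] (S : ι → Finset A) (T : Finset ι) (hT : T.Nonempty)
    (hfl : ∀ i ∈ T, ∀ j ∈ T, S i ⊆ S j ∨ S j ⊆ S i) : ∃ j ∈ T, ∀ i ∈ T, S i ⊆ S j := by
  obtain ⟨j, hj, hmax⟩ := Finset.exists_max_image T (fun i => (S i).card) hT
  refine ⟨j, hj, fun i hi => ?_⟩
  rcases hfl i hi j hj with h | h
  · exact h
  · exact (Finset.eq_of_subset_of_card_le h (hmax i hi)).symm.subset

theorem flag_null (hM : IsMatroid Ind) {ι : Type*} [DecidableEq ι] (S : ι → Finset A)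
    (hinj : Function.Injective S) (hS : ∀ i, (S i).Nonempty ∧ IsCyc Ind (S i)) (n : ℕ) :
    ∀ (T : Finset ι) (U : Finset A), T.card = n →
      (∀ i ∈ T, ∀ j ∈ T, S i ⊆ S j ∨ S j ⊆ S i) → U.Nonempty → IsCyc Ind U →
      (∀ i ∈ T, S i ⊂ U) → n + 1 + matRank Ind U ≤ U.card := by
  induction n with
  | zero =>
    intro T U _ _ hU hc _
    have := null_strict hM (W := ∅) (Finset.empty_ssubset.mpr hU) hc
    rw [rank_empty] at this
    simpa using this
  | succ n ih =>
    intro T U hT hfl hU hc hlt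
    obtain ⟨j, hj, hmax⟩ := flag_max S T (Finset.card_pos.mp (by omega)) hfl
    have h1 := ih (T.erase j) (S j) (by rw [Finset.card_erase_of_mem hj]; omega)
      (fun i hi k hk => hfl i (Finset.mem_of_mem_erase hi) k (Finset.mem_of_mem_erase hk))
      (hS j).1 (hS j).2 (fun i hi => (hmax i (Finset.mem_of_mem_erase hi)).ssubset_of_ne
        (fun h => Finset.ne_of_mem_erase hi (hinj h)))
    have h2 := null_strict hM (hlt j hj) hc
    omega

end MatroidPart

/-- (Kalai–Meshulam) If `ρ(V ∖ σ) ≥ ℓ_σ + 1` for every face `σ` of `X`, where `ℓ_σ` is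
the minimal `ℓ ≥ -1` with `H̃ᵢ(lk(X,σ)) = 0` for all `i ≥ ℓ`, then `M ⊄ X`.
Here `RHom L (i+1) = H̃ᵢ(L)`, so `ℓ_σ + 1 = sInf {n | ∀ i ≥ n, RHom (lk(X,σ)) i = 0}`. -/
theorem stmt_12 {V : Type*} [DecidableEq V] [LinearOrder V] [Fintype V]
    (K : Finset V → Prop) [DecidablePred K]
    (hcomplex : ∀ ⦃σ τ : Finset V⦄, K τ → σ ⊆ τ → K σ)
    (Ind : Finset V → Prop) [DecidablePred Ind] (hM : IsMatroid Ind)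
    (hyp : ∀ σ : Finset V, K σ →
      sInf {n : ℕ | ∀ i : ℕ, n ≤ i →
          Subsingleton (RHom (fun τ : Finset V => τ ∩ σ = ∅ ∧ K (σ ∪ τ)) i)}
        ≤ matRank Ind (Finset.univ \ σ)) :
    ∃ σ : Finset V, Ind σ ∧ ¬ K σ := by
  classical
  by_contra hcon
  push Not at hcon
  -- acyclicity of links
  have hs : ∀ (W : Finset V) (i : ℕ), matRank Ind W ≤ i → Subsingleton (RHom (fun τ : Finset V =>
      τ ∩ (Finset.univ \ W) = ∅ ∧ K ((Finset.univ \ W) ∪ τ)) i) := by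
    intro W i hi
    by_cases hK : K (Finset.univ \ W)
    · have h1 := hyp _ hK
      rw [Finset.sdiff_sdiff_eq_self (Finset.subset_univ W)] at h1
      have hne : {n : ℕ | ∀ i : ℕ, n ≤ i → Subsingleton (RHom (fun τ : Finset V =>
          τ ∩ (Finset.univ \ W) = ∅ ∧ K ((Finset.univ \ W) ∪ τ)) i)}.Nonempty := by
        refine ⟨Fintype.card V + 1, fun i hi => ?_⟩
        have : IsEmpty {σ : Finset V // (σ ∩ (Finset.univ \ W) = ∅ ∧ K ((Finset.univ \ W) ∪ σ))
            ∧ σ.card = i} := by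
          refine ⟨fun σ => ?_⟩
          have h1 := σ.2.2
          have h2 := Finset.card_le_univ σ.1
          omega
        have hsub : Subsingleton (Chains (fun τ : Finset V =>
          τ ∩ (Finset.univ \ W) = ∅ ∧ K ((Finset.univ \ W) ∪ τ)) i) := inferInstance
        rw [Submodule.Quotient.subsingleton_iff, Submodule.eq_top_iff']
        intro x
        rw [Subsingleton.elim x 0]
        exact Submodule.zero_mem _
      exact Nat.sInf_mem hne i (h1.trans hi)
    · have : IsEmpty {σ : Finset V // (σ ∩ (Finset.univ \ W) = ∅ ∧ K ((Finset.univ \ W) ∪ σ))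
            ∧ σ.card = i} := by
        refine ⟨fun σ => ?_⟩
        exact hK (hcomplex σ.2.1.2 Finset.subset_union_left)
      have hsub : Subsingleton (Chains (fun τ : Finset V =>
          τ ∩ (Finset.univ \ W) = ∅ ∧ K ((Finset.univ \ W) ∪ τ)) i) := inferInstance
      rw [Submodule.Quotient.subsingleton_iff, Submodule.eq_top_iff']
      intro x
      rw [Subsingleton.elim x 0]
      exact Submodule.zero_mem _
  have hVK : ¬ K Finset.univ := by
    intro hK
    obtain ⟨χ, _, hχ⟩ := cohom (fun τ : Finset V =>
      τ ∩ (Finset.univ \ ∅) = ∅ ∧ K ((Finset.univ \ ∅) ∪ τ)) (by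
        intro σ τ h hst
        refine ⟨?_, hcomplex h.2 (Finset.union_subset_union_right hst)⟩
        have := h.1
        simp only [Finset.sdiff_empty, Finset.inter_univ] at this ⊢
        rw [this] at hst
        exact Finset.subset_empty.mp hst) 0 (hs ∅ 0 (by rw [rank_empty])) (fun _ => 1) (by
        intro σ h hc
        have := h.1
        simp only [Finset.sdiff_empty, Finset.inter_univ] at this
        rw [this] at hc
        simp at hc)
    have := hχ ∅ (by simpa using hK) rfl
    simp at this
  have hdep : ∀ τ, ¬ K (Finset.univ \ τ) → (core Ind (Finset.univ \ τ)).Nonempty :=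
    fun τ h => core_nonempty hM (fun hI => h (hcon _ hI))
  have hYd : ∀ ⦃σ τ : Finset V⦄, ¬ K (Finset.univ \ τ) → σ ⊆ τ → ¬ K (Finset.univ \ σ) :=
    fun σ τ h hst hK => h (hcomplex hK (Finset.sdiff_subset_sdiff le_rfl hst))
  -- enumeration of cyclic sets
  let ι := {W : Finset V // W.Nonempty ∧ IsCyc Ind W}
  obtain ⟨N, ⟨e⟩⟩ : ∃ N, Nonempty (ι ≃ Fin N) := ⟨_, ⟨Fintype.equivFin ι⟩⟩
  let S : Fin N → Finset V := fun i => (e.symm i).1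
  have hS : ∀ i, (S i).Nonempty ∧ IsCyc Ind (S i) := fun i => (e.symm i).2
  have hinj : Function.Injective S := fun i j h => e.symm.injective (Subtype.ext h)
  have hsurj : ∀ W : Finset V, W.Nonempty → IsCyc Ind W → ∃ i, S i = W := fun W h1 h2 =>
    ⟨e ⟨W, h1, h2⟩, by simp [S]⟩
  clear_value S
  let P : Finset (Fin N) → Prop := fun T => ∀ i ∈ T, ∀ j ∈ T, S i ⊆ S j ∨ S j ⊆ S i
  have hP : ∀ ⦃σ τ : Finset (Fin N)⦄, P τ → σ ⊆ τ → P σ :=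
    fun σ τ h hst i hi j hj => h i (hst hi) j (hst hj)
  have hPe : P ∅ := by intro i hi; simp at hi
  have hmaxT : ∀ T, P T → T.Nonempty → ∃ j ∈ T, T.biUnion S = S j := by
    intro T hT hne
    obtain ⟨j, hj, hmax⟩ := flag_max S T hne hT
    exact ⟨j, hj, le_antisymm (Finset.biUnion_subset.mpr hmax) (Finset.subset_biUnion_of_mem S hj)⟩
  -- the map from flags to the dual complex
  obtain ⟨F, hF0, hFP, hF⟩ := acyclic_carrier (B := V) P hP
    (fun T ω => ¬ K (Finset.univ \ ω) ∧ ω ⊆ T.biUnion S)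
    (fun σ τ hst _ ω h => ⟨h.1, h.2.trans (Finset.biUnion_subset_biUnion_of_subset_left _ hst)⟩)
    ⟨by simpa using hVK, Finset.empty_subset _⟩ (by
      intro T n hT hc z hz hdz
      have hne : T.Nonempty := Finset.card_pos.mp (by omega)
      obtain ⟨j, hj, hU⟩ := hmaxT T hT hne
      simp only [hU] at hz ⊢
      refine fill K hcomplex (S j) (hS j).1 (matRank Ind (S j)) (hs (S j)) n ?_ z hz hdz
      refine flag_null hM S hinj hS n (T.erase j) (S j) (by rw [Finset.card_erase_of_mem hj]; omega)
        (hP hT (Finset.erase_subset _ _)) (hS j).1 (hS j).2 ?_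
      intro i hi
      refine HasSubset.Subset.ssubset_of_ne ?_ (fun h => Finset.ne_of_mem_erase hi (hinj h))
      rw [← hU]
      exact Finset.subset_biUnion_of_mem S (Finset.mem_of_mem_erase hi))
  -- the map back
  obtain ⟨G, hG0, hGP, hG⟩ := acyclic_carrier (B := Fin N) (fun τ : Finset V => ¬ K (Finset.univ \ τ)) hYd
    (fun τ T => P T ∧ ∀ j ∈ T, ∃ τ' ⊆ τ, τ'.Nonempty ∧ S j = core Ind (Finset.univ \ τ'))
    (fun σ τ hst _ T h => ⟨h.1, fun j hj => by
      obtain ⟨τ', h1, h2⟩ := h.2 j hj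
      exact ⟨τ', h1.trans hst, h2⟩⟩)
    ⟨hPe, by simp⟩ (by
      intro τ n hτ hc z hz hdz
      obtain ⟨a, ha⟩ := hsurj _ (hdep τ hτ) (core_cyc Ind _)
      have hde := del_eop a z
      rw [hdz, map_zero, add_zero] at hde
      refine ⟨eop a z, ?_, hde⟩
      intro ω hω
      rw [eop_apply] at hω
      split_ifs at hω with haω
      swap
      · exact absurd rfl hω
      obtain ⟨⟨h1, h2⟩, h3⟩ := hz _ (right_ne_zero_of_mul hω)
      have hle : ∀ j ∈ ω, S a ⊆ S j := by
        intro j hj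
        by_cases hja : j = a
        · rw [hja]
        · obtain ⟨τ', h4, _, h5⟩ := h2 j (Finset.mem_erase.mpr ⟨hja, hj⟩)
          rw [ha, h5]
          exact core_mono Ind (Finset.sdiff_subset_sdiff le_rfl h4)
      refine ⟨⟨?_, ?_⟩, by rw [← Finset.card_erase_add_one haω, h3]⟩
      · intro i hi j hj
        by_cases hia : i = a
        · subst hia; exact Or.inl (hle j hj)
        by_cases hja : j = a
        · subst hja; exact Or.inr (hle i hi)
        exact h1 i (Finset.mem_erase.mpr ⟨hia, hi⟩) j (Finset.mem_erase.mpr ⟨hja, hj⟩)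
      · intro j hj
        by_cases hja : j = a
        · subst hja
          exact ⟨τ, le_rfl, Finset.card_pos.mp (by omega), ha⟩
        · exact h2 j (Finset.mem_erase.mpr ⟨hja, hj⟩))
  obtain ⟨m, hm⟩ := hsurj _ (hdep ∅ (by simpa using hVK)) (core_cyc Ind _)
  have hGdel : ∀ c : EE V, SuppIn (fun τ => ¬ K (Finset.univ \ τ)) c →
      del (lext G c) = lext G (del c) := by
    intro c hc
    have h1 : c = ∑ τ, c τ • bs τ := by
      ext ω; simp [bs_apply]
    conv_rhs => rw [h1]
    rw [lext_apply, map_sum, map_sum, map_sum]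
    refine Finset.sum_congr rfl fun τ _ => ?_
    rw [map_smul, map_smul, map_smul]
    by_cases h : c τ = 0
    · simp [h]
    · rw [lext_del_bs, (hG τ (hc τ h)).2]
  have hFne : ∀ T, ¬ P T → F T = 0 := fun T h => hFP T h (by rintro rfl; exact h hPe)
  refine cone_trace P hP m ?_ (fun T => lext G (F T)) ?_ ?_ ?_ ?_ ?_
  · intro T hT i hi j hj
    have hle : ∀ j, S j ⊆ S m := by
      intro j; rw [hm]
      exact (hS j).2.subset_core (by simp)
    rw [Finset.mem_insert] at hi hj
    rcases hi with rfl | hi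
    · exact Or.inr (hle j)
    rcases hj with rfl | hj
    · exact Or.inl (hle i)
    exact hT i hi j hj
  · simp only [hF0, lext_bs, hG0]
  · intro T hT
    simp only [hFne T hT, map_zero]
  · intro T hT
    simp only [lext_apply]
    refine SuppIn.sum _ _ _ fun τ _ hτ => ?_
    have h1 := (hF T hT).1 τ hτ
    exact (hG τ h1.1.1).1.mono fun ω h => h.1.1
  · intro T hT
    rw [hGdel _ ((hF T hT).1.mono fun ω h => h.1.1), (hF T hT).2, map_sum]
    simp only [map_smul]
  · intro T hTne
    by_contra hne
    by_cases hT : P T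
    swap
    · exact hne (by simp [hFne T hT])
    obtain ⟨j, hj, hU⟩ := hmaxT T hT (Finset.nonempty_iff_ne_empty.mpr hTne)
    rw [lext_apply, Finset.sum_apply] at hne
    obtain ⟨τ, _, hτ⟩ := Finset.exists_ne_zero_of_sum_ne_zero hne
    simp only [Pi.smul_apply, smul_eq_mul] at hτ
    obtain ⟨⟨h1, h2⟩, h3⟩ := (hF T hT).1 τ (left_ne_zero_of_mul hτ)
    obtain ⟨⟨h4, h5⟩, h6⟩ := (hG τ h1).1 T (right_ne_zero_of_mul hτ)
    obtain ⟨τ', h7, ⟨t, ht⟩, h8⟩ := h5 j hj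
    have h9 : t ∈ S j := by rw [← hU]; exact h2 (h7 ht)
    rw [h8] at h9
    have := core_subset Ind _ h9
    simp [ht] at this
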